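/- There exist a constant c > 0 and an integer L₀ such that for all ℓ ≥ L₀, width(Y(ℓ)) ≥ c·ℓ (in fact width(Y(ℓ)) ≥ ℓ/4 − 1 for all sufficiently large ℓ). -/

import Mathlib

/-- A Dyck word: entries ±1, total sum zero, all prefix sums nonnegative. -/
def IsDyck (w : List ℤ) : Prop :=
  (∀ a ∈ w, a = 1 ∨ a = -1) ∧ w.sum = 0 ∧ ∀ k, 0 ≤ (w.take k).sum

/-- Width of a finite set of naturals: the least number of intervals of
consecutive integers whose union equals the set. -/
noncomputable def setWidth (S : Finset ℕ) : ℕ :=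
  sInf {k | ∃ f : Fin k → ℕ × ℕ, (S : Set ℕ) = ⋃ i, Set.Icc (f i).1 (f i).2}

/-- A re-pairing of a word `w` over `{+1, -1}` (positions are 0-based):
a sequence of pairs (ℓᵢ, rᵢ) with w(ℓᵢ) = +1, w(rᵢ) = −1, ℓᵢ < rᵢ, such that
every position of `w` occurs in exactly one pair. -/
structure RePairing (w : List ℤ) where
  pairs : List (ℕ × ℕ)
  perm : (pairs.flatMap fun q => [q.1, q.2]).Perm (List.range w.length)
  lt : ∀ q ∈ pairs, q.1 < q.2
  plus : ∀ q ∈ pairs, w.getD q.1 0 = 1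
  minus : ∀ q ∈ pairs, w.getD q.2 0 = -1

/-- The width of a re-pairing: maximum over times `t` of the width of the set
of positions erased within the first `t` pairs. -/
noncomputable def repWidth {w : List ℤ} (p : RePairing w) : ℕ :=
  (Finset.range (p.pairs.length + 1)).sup
    fun t => setWidth ((p.pairs.take t).flatMap fun q => [q.1, q.2]).toFinset

/-- Width of a word: minimum width over all its re-pairings. -/
noncomputable def dyckWidth (w : List ℤ) : ℕ :=
  sInf {k | ∃ p : RePairing w, repWidth p = k}

/-- X(a₀) = +^{a₀} −^{a₀};
X(a₀,…,a_{k+1}) = +^{a_{k+1}} X(a₀,…,a_k) X(a₀,…,a_k) −^{a_{k+1}}. -/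
def Xword (a : ℕ → ℕ) : ℕ → List ℤ
  | 0 => List.replicate (a 0) 1 ++ List.replicate (a 0) (-1)
  | k + 1 => List.replicate (a (k + 1)) 1 ++ Xword a k ++ Xword a k
      ++ List.replicate (a (k + 1)) (-1)

/-- Y(m,ℓ) = X(a₀,…,a_{mℓ−1}) with aᵢ = 2^{⌊i/ℓ⌋}. -/
def Yword (m ℓ : ℕ) : List ℤ := Xword (fun i => 2 ^ (i / ℓ)) (m * ℓ - 1)

/-- Y(ℓ) = Y(⌊ℓ·log₂ ℓ⌋, ℓ). -/
noncomputable def YwordL (ℓ : ℕ) : List ℤ := Yword ⌊(ℓ : ℝ) * Real.logb 2 (ℓ : ℝ)⌋₊ ℓ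

/-- The number of places where membership in `S` changes is at most twice the width of `S`. -/
theorem card_boundary_le (S F : Finset ℕ) (hF : ∀ q ∈ F, ¬(q ∈ S ↔ q + 1 ∈ S)) :
    F.card ≤ 2 * setWidth S := by
  have hne : {k | ∃ f : Fin k → ℕ × ℕ,
      (S : Set ℕ) = ⋃ i, Set.Icc (f i).1 (f i).2}.Nonempty := by
    refine ⟨S.card, fun i => ((S.equivFin.symm i : ℕ), (S.equivFin.symm i : ℕ)), ?_⟩
    ext x
    simp only [Finset.mem_coe, Set.Icc_self, Set.mem_iUnion, Set.mem_singleton_iff]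
    constructor
    · intro hx
      exact ⟨S.equivFin ⟨x, hx⟩, by simp⟩
    · rintro ⟨i, rfl⟩
      exact (S.equivFin.symm i).2
  obtain ⟨f, hf⟩ := Nat.sInf_mem hne
  change Fin (setWidth S) → ℕ × ℕ at f
  change (S : Set ℕ) = ⋃ i : Fin (setWidth S), Set.Icc (f i).1 (f i).2 at hf
  have hmem : ∀ x, x ∈ S ↔ ∃ i, (f i).1 ≤ x ∧ x ≤ (f i).2 := by
    intro x
    rw [← Finset.mem_coe, hf]
    simp
  have hsub : F ⊆ (Finset.univ.image fun i => (f i).2) ∪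
      (Finset.univ.image fun i => (f i).1 - 1) := by
    intro q hq
    have h := hF q hq
    simp only [Finset.mem_union, Finset.mem_image, Finset.mem_univ, true_and]
    by_cases h1 : q ∈ S
    · left
      have h2 : q + 1 ∉ S := fun h2 => h ⟨fun _ => h2, fun _ => h1⟩
      obtain ⟨i, hi⟩ := (hmem q).1 h1
      refine ⟨i, ?_⟩
      by_contra hc
      exact h2 ((hmem _).2 ⟨i, by omega, by omega⟩)
    · right
      have h2 : q + 1 ∈ S := by
        by_contra h2
        exact h ⟨fun h' => absurd h' h1, fun h' => absurd h' h2⟩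
      obtain ⟨i, hi⟩ := (hmem _).1 h2
      refine ⟨i, ?_⟩
      by_contra hc
      exact h1 ((hmem _).2 ⟨i, by omega, by omega⟩)
  calc F.card ≤ _ := Finset.card_le_card hsub
    _ ≤ _ := Finset.card_union_le _ _
    _ ≤ setWidth S + setWidth S := by
        refine add_le_add ?_ ?_ <;>
        exact Finset.card_image_le.trans (by simp)
    _ = _ := by ring

/-- A property of words that holds for the empty word and is preserved by concatenation and by
surrounding with a pair of brackets (raising the height by one) holds for all words `X`. -/
theorem Xword_induction (Q : ℕ → List ℤ → Prop) (a : ℕ → ℕ) (nil : Q 0 [])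
    (append : ∀ H u v, Q H u → Q H v → Q H (u ++ v))
    (wrap : ∀ H u, Q H u → Q (H + 1) (1 :: u ++ [-1])) (k : ℕ) :
    Q (∑ i ∈ Finset.range (k + 1), a i) (Xword a k) := by
  have hrep : ∀ n H u, Q H u →
      Q (H + n) (List.replicate n 1 ++ u ++ List.replicate n (-1)) := by
    intro n
    induction n with
    | zero => intro H u h; simpa using h
    | succ n ih =>
      intro H u h
      have := wrap _ _ (ih H u h)
      rw [List.replicate_succ, List.replicate_succ']
      simpa [add_assoc] using this
  induction k with
  | zero => simpa [Xword] using hrep (a 0) 0 [] nil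
  | succ k ih =>
    rw [Finset.sum_range_succ]
    have := hrep (a (k + 1)) _ _ (append _ _ _ ih ih)
    simpa [Xword] using this

theorem RePairing.nonempty_append {u v : List ℤ} (p : RePairing u) (q : RePairing v) :
    Nonempty (RePairing (u ++ v)) := by
  have hp : ∀ x ∈ p.pairs, x.1 < u.length ∧ x.2 < u.length := by
    intro x hx
    constructor <;>
    · rw [← List.mem_range, ← p.perm.mem_iff, List.mem_flatMap]
      exact ⟨x, hx, by simp⟩
  refine ⟨⟨p.pairs ++ q.pairs.map fun x => (u.length + x.1, u.length + x.2), ?_, ?_, ?_, ?_⟩⟩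
  · rw [List.flatMap_append, List.length_append, List.range_add]
    refine p.perm.append ?_
    have := q.perm.map (u.length + ·)
    simpa [List.flatMap_map, List.map_flatMap] using this
  · intro x hx
    rcases List.mem_append.1 hx with h | h
    · exact p.lt x h
    · obtain ⟨y, hy, rfl⟩ := List.mem_map.1 h
      simpa using q.lt y hy
  · intro x hx
    rcases List.mem_append.1 hx with h | h
    · rw [List.getD_append _ _ _ _ (hp x h).1]
      exact p.plus x h
    · obtain ⟨y, hy, rfl⟩ := List.mem_map.1 h
      rw [List.getD_append_right _ _ _ _ (by simp)]
      simpa using q.plus y hy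
  · intro x hx
    rcases List.mem_append.1 hx with h | h
    · rw [List.getD_append _ _ _ _ (hp x h).2]
      exact p.minus x h
    · obtain ⟨y, hy, rfl⟩ := List.mem_map.1 h
      rw [List.getD_append_right _ _ _ _ (by simp)]
      simpa using q.minus y hy

theorem RePairing.nonempty_wrap {u : List ℤ} (p : RePairing u) :
    Nonempty (RePairing (1 :: u ++ [-1])) := by
  have hp : ∀ x ∈ p.pairs, x.1 < u.length ∧ x.2 < u.length := by
    intro x hx
    constructor <;>
    · rw [← List.mem_range, ← p.perm.mem_iff, List.mem_flatMap]
      exact ⟨x, hx, by simp⟩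
  refine ⟨⟨(0, u.length + 1) :: p.pairs.map fun x => (x.1 + 1, x.2 + 1), ?_, ?_, ?_, ?_⟩⟩
  · have h := p.perm.map (· + 1)
    have h2 : (List.range (1 :: u ++ [-1]).length) =
        0 :: ((List.range u.length).map (· + 1) ++ [u.length + 1]) := by
      have hl : ((1 : ℤ) :: u ++ [-1]).length = u.length + 1 + 1 := by simp
      rw [hl, List.range_succ_eq_map,
        List.range_succ, List.map_append]
      simp
    rw [h2]
    simp only [List.flatMap_cons, List.flatMap_map, List.cons_append, List.nil_append]
    refine List.Perm.cons _ ?_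
    refine (List.Perm.cons _ ?_).trans (List.perm_append_singleton _ _).symm
    simpa [List.map_flatMap] using h
  · intro x hx
    rcases List.mem_cons.1 hx with h | h
    · simp [h]
    · obtain ⟨y, hy, rfl⟩ := List.mem_map.1 h
      simpa using p.lt y hy
  · intro x hx
    rcases List.mem_cons.1 hx with h | h
    · simp [h]
    · obtain ⟨y, hy, rfl⟩ := List.mem_map.1 h
      rw [List.getD_append _ _ _ _ (by simpa using (hp y hy).1)]
      simpa using p.plus y hy
  · intro x hx
    rcases List.mem_cons.1 hx with h | h
    · subst h
      rw [List.getD_append_right _ _ _ _ (by simp)]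
      simp
    · obtain ⟨y, hy, rfl⟩ := List.mem_map.1 h
      rw [List.getD_append _ _ _ _ (by simpa using (hp y hy).2)]
      simpa using p.minus y hy

theorem nonempty_rePairing_Xword (a : ℕ → ℕ) (k : ℕ) : Nonempty (RePairing (Xword a k)) := by
  refine Xword_induction (fun _ w => Nonempty (RePairing w)) a ?_ ?_ ?_ k
  · exact ⟨⟨[], by simp, by simp, by simp, by simp⟩⟩
  · rintro _ u v ⟨p⟩ ⟨q⟩
    exact p.nonempty_append q
  · rintro _ u ⟨p⟩
    exact p.nonempty_wrap

theorem Xword_prefix_sums (a : ℕ → ℕ) (k : ℕ) :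
    (Xword a k).sum = 0 ∧ ∀ j, 0 ≤ ((Xword a k).take j).sum ∧
      ((Xword a k).take j).sum ≤ ((∑ i ∈ Finset.range (k + 1), a i : ℕ) : ℤ) := by
  refine Xword_induction (fun H w => w.sum = 0 ∧ ∀ j, 0 ≤ (w.take j).sum ∧
      (w.take j).sum ≤ (H : ℤ)) a ?_ ?_ ?_ k
  · simp
  · rintro H u v ⟨hu, hu'⟩ ⟨hv, hv'⟩
    refine ⟨by simp [hu, hv], fun j => ?_⟩
    rw [List.take_append, List.sum_append]
    rcases le_total j u.length with h | h
    · simpa [Nat.sub_eq_zero_of_le h] using hu' j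
    · rw [List.take_of_length_le h, hu, zero_add]
      exact hv' _
  · rintro H u ⟨hu, hu'⟩
    refine ⟨by simp [hu], fun j => ?_⟩
    rcases j with _ | j
    · simp; positivity
    · rw [List.cons_append, List.take_succ_cons, List.sum_cons, List.take_append, List.sum_append]
      have := hu' j
      rcases le_or_gt j u.length with h | h
      · simp only [Nat.sub_eq_zero_of_le h, List.take_zero, List.sum_nil]
        push_cast
        omega
      · rw [List.take_of_length_le h.le, hu,
          List.take_of_length_le (by simp; omega)]
        simp
        positivity

/-- The set of positions erased by the first `t` pairs. -/
def RePairing.erased {w : List ℤ} (p : RePairing w) (t : ℕ) : Finset ℕ :=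
  ((p.pairs.take t).flatMap fun q => [q.1, q.2]).toFinset

/-- The sum of the letters at the positions below `x` erased by the first `t` pairs. -/
def RePairing.charge {w : List ℤ} (p : RePairing w) (t x : ℕ) : ℤ :=
  ((p.pairs.take t).map fun q =>
    (if q.1 < x then (1 : ℤ) else 0) - (if q.2 < x then 1 else 0)).sum

/-- The number of `q` with `x ≤ q` and `q + 1 < y` such that exactly one of the positions
`q` and `q + 1` is erased by the first `t` pairs. -/
def RePairing.changes {w : List ℤ} (p : RePairing w) (t x y : ℕ) : ℕ :=
  ((Finset.Ico x (y - 1)).filter fun q => ¬(q ∈ p.erased t ↔ q + 1 ∈ p.erased t)).card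

/-- The height of the word `w` before position `x`. -/
def height (w : List ℤ) (x : ℕ) : ℤ := (w.take x).sum

theorem height_succ (w : List ℤ) (x : ℕ) : height w (x + 1) = height w x + w.getD x 0 := by
  unfold height
  rw [List.take_add_one, List.sum_append, List.getD_eq_getElem?_getD]
  cases w[x]? <;> simp

namespace RePairing

variable {w : List ℤ} (p : RePairing w)

theorem erased_mono {t t' : ℕ} (h : t ≤ t') : p.erased t ⊆ p.erased t' := by
  intro x hx
  simp only [erased, List.mem_toFinset, List.mem_flatMap] at hx ⊢
  obtain ⟨q, hq, hx⟩ := hx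
  exact ⟨q, (List.take_prefix_take_left h).subset hq, hx⟩

theorem erased_zero : p.erased 0 = ∅ := by simp [erased]

theorem erased_length : p.erased p.pairs.length = Finset.range w.length := by
  ext x
  simp only [erased, List.take_length, List.mem_toFinset, Finset.mem_range]
  rw [p.perm.mem_iff, List.mem_range]

theorem exists_erased_succ_subset (t : ℕ) :
    ∃ F : Finset ℕ, F.card ≤ 2 ∧ p.erased (t + 1) ⊆ p.erased t ∪ F := by
  unfold erased
  rw [List.take_add_one, List.flatMap_append, List.toFinset_append]
  refine ⟨_, ?_, le_rfl⟩
  cases p.pairs[t]? with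
  | none => simp
  | some q => exact (List.toFinset_card_le _).trans (by simp)

theorem charge_succ (t x : ℕ) :
    p.charge t (x + 1) = p.charge t x + if x ∈ p.erased t then w.getD x 0 else 0 := by
  have key : ∀ L : List (ℕ × ℕ), (L.flatMap fun q => [q.1, q.2]).Nodup →
      (∀ q ∈ L, w.getD q.1 0 = 1) → (∀ q ∈ L, w.getD q.2 0 = -1) →
      (L.map fun q => (if q.1 < x + 1 then (1 : ℤ) else 0) - (if q.2 < x + 1 then 1 else 0)).sum =
      (L.map fun q => (if q.1 < x then (1 : ℤ) else 0) - (if q.2 < x then 1 else 0)).sum +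
        if x ∈ L.flatMap (fun q => [q.1, q.2]) then w.getD x 0 else 0 := by
    intro L
    induction L with
    | nil => simp
    | cons q L ih =>
      intro hn hp hm
      rw [List.flatMap_cons, List.nodup_append] at hn
      obtain ⟨hn1, hn2, hn3⟩ := hn
      have ih' := ih hn2 (fun q hq => hp q (List.mem_cons_of_mem _ hq))
        (fun q hq => hm q (List.mem_cons_of_mem _ hq))
      have hp1 := hp q List.mem_cons_self
      have hm1 := hm q List.mem_cons_self
      have hne : q.1 ≠ q.2 := by simpa using hn1
      have h1 : q.1 ∉ L.flatMap (fun q => [q.1, q.2]) := fun h => hn3 q.1 (by simp) _ h rfl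
      have h2 : q.2 ∉ L.flatMap (fun q => [q.1, q.2]) := fun h => hn3 q.2 (by simp) _ h rfl
      simp only [List.map_cons, List.sum_cons, ih', List.flatMap_cons, List.mem_append,
        List.mem_cons, List.not_mem_nil, or_false]
      by_cases hx1 : x = q.1
      · subst hx1
        simp only [h1, true_or, if_true, if_false, hp1]
        split_ifs <;> omega
      · by_cases hx2 : x = q.2
        · subst hx2
          simp only [h2, or_true, true_or, if_true, if_false, hm1]
          split_ifs <;> omega
        · simp only [hx1, hx2, false_or]
          have e1 : (q.1 < x + 1) ↔ q.1 < x := by omega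
          have e2 : (q.2 < x + 1) ↔ q.2 < x := by omega
          simp only [e1, e2]
          ring
  have hsub : (p.pairs.take t).Sublist p.pairs := List.take_sublist _ _
  have hnd : (p.pairs.flatMap fun q => [q.1, q.2]).Nodup :=
    p.perm.nodup_iff.2 List.nodup_range
  have := key (p.pairs.take t) (hnd.sublist (hsub.flatMap _))
    (fun q hq => p.plus q (hsub.subset hq)) (fun q hq => p.minus q (hsub.subset hq))
  simpa only [charge, erased, List.mem_toFinset] using this

theorem charge_mono {t t' : ℕ} (h : t ≤ t') (x : ℕ) : p.charge t x ≤ p.charge t' x := by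
  induction t', h using Nat.le_induction with
  | base => exact le_rfl
  | succ n _ ih =>
    refine ih.trans ?_
    unfold charge
    rw [List.take_add_one, List.map_append, List.sum_append]
    cases hq : p.pairs[n]? with
    | none => simp
    | some q =>
      have := p.lt q (List.mem_of_getElem? hq)
      simp only [Option.toList_some, List.map_cons, List.map_nil, List.sum_cons, List.sum_nil]
      split_ifs <;> omega

theorem charge_nonneg (t x : ℕ) : 0 ≤ p.charge t x := by
  have := p.charge_mono (Nat.zero_le t) x
  simpa [charge] using this

theorem charge_le_height (t x : ℕ) : p.charge t x ≤ height w x := by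
  have h0 : ∀ x, p.charge p.pairs.length x = height w x := by
    intro x
    induction x with
    | zero => simp [charge, height]
    | succ x ih =>
      rw [charge_succ, height_succ, ih, erased_length]
      split_ifs with h
      · rfl
      · rw [List.getD_eq_default _ _ (by simpa using h)]
  rw [← h0]
  rcases le_total t p.pairs.length with h | h
  · exact p.charge_mono h x
  · simp [charge, List.take_of_length_le h]

theorem charge_of_erased {t x y : ℕ} (hxy : x ≤ y) (h : ∀ q, x ≤ q → q < y → q ∈ p.erased t) :
    p.charge t y - p.charge t x = height w y - height w x := by
  induction y, hxy using Nat.le_induction with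
  | base => simp
  | succ n hn ih =>
    rw [charge_succ, height_succ, if_pos (h n hn (by omega))]
    have := ih fun q h1 h2 => h q h1 (by omega)
    omega

theorem charge_of_not_erased {t x y : ℕ} (hxy : x ≤ y)
    (h : ∀ q, x ≤ q → q < y → q ∉ p.erased t) : p.charge t y = p.charge t x := by
  induction y, hxy using Nat.le_induction with
  | base => simp
  | succ n hn ih =>
    rw [charge_succ, if_neg (h n hn (by omega)), ih fun q h1 h2 => h q h1 (by omega), add_zero]

theorem mem_erased_iff_of_no_change {t x y : ℕ} (hxy : x ≤ y)
    (h : ∀ q, x ≤ q → q < y → (q ∈ p.erased t ↔ q + 1 ∈ p.erased t)) :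
    x ∈ p.erased t ↔ y ∈ p.erased t := by
  induction y, hxy using Nat.le_induction with
  | base => rfl
  | succ n hn ih => exact (ih fun q h1 h2 => h q h1 (by omega)).trans (h n hn (by omega))

/-- Abel summation: over a segment on which the height varies by at most `H`, the charge is
controlled by the number of changes. -/
theorem abs_charge_sub_le {t x y : ℕ} {H : ℤ} (hxy : x < y) (hy : height w y = height w x)
    (hH : ∀ z, x ≤ z → z ≤ y → height w x ≤ height w z ∧ height w z ≤ height w x + H) :
    |p.charge t y - p.charge t x| ≤ H * p.changes t x y := by
  have key : ∀ n, x + n + 1 ≤ y →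
      |p.charge t (x + n + 1) - p.charge t x - (if x + n ∈ p.erased t then
        height w (x + n + 1) - height w x else 0)| ≤ H * p.changes t x (x + n + 1) := by
    intro n
    induction n with
    | zero =>
      intro _
      rw [add_zero, charge_succ, height_succ]
      simp [changes]
    | succ n ih =>
      intro hn
      have ih' := ih (by omega)
      have hz := hH (x + n + 1) (by omega) (by omega)
      rw [charge_succ, height_succ]
      have hc : (p.changes t x (x + (n + 1) + 1) : ℤ) = p.changes t x (x + n + 1) +
          if (x + n ∈ p.erased t ↔ x + n + 1 ∈ p.erased t) then 0 else 1 := by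
        unfold changes
        rw [show x + (n + 1) + 1 - 1 = x + n + 1 by omega, show x + n + 1 - 1 = x + n by omega,
          ← Finset.insert_Ico_right_eq_Ico_add_one (by omega), Finset.filter_insert]
        by_cases h : (x + n ∈ p.erased t ↔ x + n + 1 ∈ p.erased t)
        · simp [h]
        · rw [if_pos h, if_neg h, Finset.card_insert_of_notMem (by simp)]
          push_cast
          rfl
      rw [hc, show x + (n + 1) = x + n + 1 by omega]
      rw [abs_le] at ih' ⊢
      by_cases h1 : x + n ∈ p.erased t <;> by_cases h2 : x + n + 1 ∈ p.erased t <;>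
        simp only [h1, h2, if_true, if_false, iff_true, iff_false, not_true,
          mul_add, mul_one, add_zero] at ih' ⊢ <;>
        constructor <;> linarith
  have h := key (y - x - 1) (by omega)
  rw [show x + (y - x - 1) + 1 = y by omega, hy] at h
  simpa using h

end RePairing

/-- The word `u` occurs in `w` starting from position `s`. -/
def OccursAt (w u : List ℤ) (s : ℕ) : Prop :=
  ∃ pre post, w = pre ++ u ++ post ∧ pre.length = s

theorem OccursAt.height_add {w u : List ℤ} {s j : ℕ} (h : OccursAt w u s) (hj : j ≤ u.length) :
    height w (s + j) = height w s + (u.take j).sum := by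
  obtain ⟨pre, post, rfl, rfl⟩ := h
  unfold height
  rw [List.append_assoc, List.take_length_add_append, List.take_left, List.sum_append,
    List.take_append_of_le_length hj]

theorem OccursAt.add_length_le {w u : List ℤ} {s : ℕ} (h : OccursAt w u s) :
    s + u.length ≤ w.length := by
  obtain ⟨pre, post, rfl, rfl⟩ := h
  simp

theorem OccursAt.trans {w u v : List ℤ} {s r : ℕ} (h : OccursAt w u s) (h' : OccursAt u v r) :
    OccursAt w v (s + r) := by
  obtain ⟨pre, post, rfl, rfl⟩ := h
  obtain ⟨pre', post', rfl, rfl⟩ := h'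
  exact ⟨pre ++ pre', post' ++ post, by simp, by simp⟩

theorem Xword_length_succ (a : ℕ → ℕ) (k : ℕ) : (Xword a (k + 1)).length =
    a (k + 1) + (Xword a k).length + (Xword a k).length + a (k + 1) := by
  simp [Xword, add_assoc]

theorem two_le_length_Xword {a : ℕ → ℕ} (ha : ∀ i, 0 < a i) (k : ℕ) :
    2 ≤ (Xword a k).length := by
  induction k with
  | zero => have := ha 0; simp [Xword]; omega
  | succ k ih => rw [Xword_length_succ]; omega

theorem Xword_occursAt_left (a : ℕ → ℕ) (k : ℕ) :
    OccursAt (Xword a (k + 1)) (Xword a k) (a (k + 1)) :=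
  ⟨List.replicate (a (k + 1)) 1, Xword a k ++ List.replicate (a (k + 1)) (-1), by simp [Xword],
    by simp⟩

theorem Xword_occursAt_right (a : ℕ → ℕ) (k : ℕ) :
    OccursAt (Xword a (k + 1)) (Xword a k) (a (k + 1) + (Xword a k).length) :=
  ⟨List.replicate (a (k + 1)) 1 ++ Xword a k, List.replicate (a (k + 1)) (-1), by simp [Xword],
    by simp⟩

theorem height_Xword_left (a : ℕ → ℕ) (k : ℕ) :
    ((Xword a (k + 1)).take (a (k + 1))).sum = a (k + 1) := by
  simp [Xword]

theorem height_Xword_right (a : ℕ → ℕ) (k : ℕ) :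
    ((Xword a (k + 1)).take (a (k + 1) + (Xword a k).length)).sum = a (k + 1) := by
  have h : Xword a (k + 1) = (List.replicate (a (k + 1)) 1 ++ Xword a k) ++
      (Xword a k ++ List.replicate (a (k + 1)) (-1)) := by simp [Xword]
  rw [h, List.take_left' (by simp)]
  simp [(Xword_prefix_sums a k).1]

/-- The factor `X(a₀,…,a_j)` at position `s'` is one of those from which the factor
`X(a₀,…,a_i)` at position `s` is built. -/
inductive IsSubfactor (a : ℕ → ℕ) : ℕ → ℕ → ℕ → ℕ → Prop
  | refl (i s : ℕ) : IsSubfactor a i s i s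
  | left {i s j s' : ℕ} : IsSubfactor a i (s + a (i + 1)) j s' → IsSubfactor a (i + 1) s j s'
  | right {i s j s' : ℕ} : IsSubfactor a i (s + (a (i + 1) + (Xword a i).length)) j s' →
      IsSubfactor a (i + 1) s j s'

namespace IsSubfactor

variable {a : ℕ → ℕ} {i j k s s' s'' : ℕ}

theorem trans (h : IsSubfactor a i s j s') (h' : IsSubfactor a j s' k s'') :
    IsSubfactor a i s k s'' := by
  induction h with
  | refl => exact h'
  | left _ ih => exact (ih h').left
  | right _ ih => exact (ih h').right

theorem start_le (h : IsSubfactor a i s j s') : s ≤ s' := by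
  induction h <;> omega

theorem end_le (h : IsSubfactor a i s j s') :
    s' + (Xword a j).length ≤ s + (Xword a i).length := by
  induction h with
  | refl => exact le_rfl
  | left _ ih => rw [Xword_length_succ]; omega
  | right _ ih => rw [Xword_length_succ]; omega

theorem occursAt {w : List ℤ} (h : IsSubfactor a i s j s') (hw : OccursAt w (Xword a i) s) :
    OccursAt w (Xword a j) s' := by
  induction h with
  | refl => exact hw
  | left _ ih => exact ih (hw.trans (Xword_occursAt_left _ _))
  | right _ ih => exact ih (hw.trans (Xword_occursAt_right _ _))

theorem height_add {w : List ℤ} (h : IsSubfactor a i s j s') (hw : OccursAt w (Xword a i) s) :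
    height w s' + ((∑ n ∈ Finset.range (j + 1), a n : ℕ) : ℤ) =
      height w s + ((∑ n ∈ Finset.range (i + 1), a n : ℕ) : ℤ) := by
  induction h with
  | refl => rfl
  | @left i s j s' _ ih =>
    rw [ih (hw.trans (Xword_occursAt_left _ _)), Finset.sum_range_succ _ (i + 1),
      hw.height_add (by rw [Xword_length_succ]; omega), height_Xword_left]
    push_cast
    ring
  | @right i s j s' _ ih =>
    rw [ih (hw.trans (Xword_occursAt_right _ _)), Finset.sum_range_succ _ (i + 1),
      hw.height_add (by rw [Xword_length_succ]; omega), height_Xword_right]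
    push_cast
    ring

theorem exists_of_le (a : ℕ → ℕ) (s : ℕ) (h : j ≤ i) : ∃ s', IsSubfactor a i s j s' := by
  induction i, h using Nat.le_induction generalizing s with
  | base => exact ⟨s, refl _ _⟩
  | succ n _ ih =>
    obtain ⟨s', hs⟩ := ih (s + a (n + 1))
    exact ⟨s', hs.left⟩

/-- If a function of the level-`j` subfactors increases by at least `κ` whenever we pass from the
left half to the right half of a subfactor of level above `k`, then it takes values differing by
at least `(2 ^ r - 1) * κ` on any factor of level `k + r`. -/
theorem exists_increase (T : ℕ → ℤ) (κ : ℤ) (hjk : j ≤ k) (r : ℕ)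
    (hT : ∀ n q u u', k ≤ n → IsSubfactor a (k + r) s (n + 1) q →
      IsSubfactor a n (q + a (n + 1)) j u →
      IsSubfactor a n (q + (a (n + 1) + (Xword a n).length)) j u' → T u + κ ≤ T u') :
    ∃ u u', IsSubfactor a (k + r) s j u ∧ IsSubfactor a (k + r) s j u' ∧
      T u + (2 ^ r - 1) * κ ≤ T u' := by
  induction r generalizing s with
  | zero =>
    obtain ⟨u, hu⟩ := exists_of_le a s hjk
    exact ⟨u, u, hu, hu, by simp⟩
  | succ r ih =>
    obtain ⟨u₁, u₂, h₁, h₂, h₁₂⟩ := ih (s := s + a (k + r + 1))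
      fun n q u u' hn hq => hT n q u u' hn hq.left
    obtain ⟨u₃, u₄, h₃, h₄, h₃₄⟩ := ih (s := s + (a (k + r + 1) + (Xword a (k + r)).length))
      fun n q u u' hn hq => hT n q u u' hn hq.right
    refine ⟨u₁, u₄, h₁.left, h₄.right, ?_⟩
    have := hT (k + r) s u₂ u₃ (by omega) (refl _ _) h₂ h₃
    rw [pow_succ]
    linarith

end IsSubfactor

/-- Every occurrence of `X(a₀,…,a_i)` shows at least `g` changes at some time. -/
def RePairing.ForcesChanges {w : List ℤ} (p : RePairing w) (a : ℕ → ℕ) (i g : ℕ) : Prop :=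
  ∀ s, OccursAt w (Xword a i) s → ∃ t, g ≤ p.changes t s (s + (Xword a i).length)

namespace RePairing

variable {w : List ℤ} (p : RePairing w) {a : ℕ → ℕ}

theorem changes_mono (t : ℕ) {x y x' y' : ℕ} (hx : x' ≤ x) (hy : y ≤ y') :
    p.changes t x y ≤ p.changes t x' y' :=
  Finset.card_le_card <| Finset.filter_subset_filter _ <|
    Finset.Ico_subset_Ico hx (Nat.sub_le_sub_right hy 1)

theorem ForcesChanges.mono {i j g : ℕ} (h : p.ForcesChanges a j g) (hij : j ≤ i) :
    p.ForcesChanges a i g := by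
  intro s hs
  obtain ⟨s', hs'⟩ := IsSubfactor.exists_of_le a s hij
  obtain ⟨t, ht⟩ := h s' (hs'.occursAt hs)
  exact ⟨t, ht.trans (p.changes_mono t hs'.start_le hs'.end_le)⟩

theorem exists_mem_and_not_mem_of_changes_pos {t x y : ℕ} (h : 1 ≤ p.changes t x y) :
    (∃ q, x ≤ q ∧ q < y ∧ q ∈ p.erased t) ∧ ∃ q, x ≤ q ∧ q < y ∧ q ∉ p.erased t := by
  obtain ⟨q, hq⟩ := Finset.card_pos.1 h
  simp only [Finset.mem_filter, Finset.mem_Ico] at hq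
  by_cases h1 : q ∈ p.erased t <;> by_cases h2 : q + 1 ∈ p.erased t
  · simp [h1, h2] at hq
  · exact ⟨⟨q, by omega, by omega, h1⟩, q + 1, by omega, by omega, h2⟩
  · exact ⟨⟨q + 1, by omega, by omega, h2⟩, q, by omega, by omega, h1⟩
  · simp [h1, h2] at hq

theorem forcesChanges_one (ha : ∀ i, 0 < a i) : p.ForcesChanges a 1 1 := by
  intro s hs
  set l := (Xword a 1).length with hl
  have hl4 : 4 ≤ l := by
    have h1 := two_le_length_Xword ha 0
    have h2 := ha 1
    rw [hl, Xword_length_succ]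
    omega
  have hex : ∃ t, ∃ q ∈ Finset.Ico s (s + l), q ∈ p.erased t := by
    refine ⟨p.pairs.length, s, by simp; omega, ?_⟩
    rw [p.erased_length, Finset.mem_range]
    have := hs.add_length_le
    omega
  classical
  obtain ⟨q, hq, hqt⟩ := Nat.find_spec hex
  have hmin := fun t => Nat.find_min hex (m := t)
  set t := Nat.find hex
  rcases ht : t with _ | t'
  · simp [ht, erased_zero] at hqt
  have hlt := hmin t' (by omega)
  obtain ⟨F, hF, hsub⟩ := p.exists_erased_succ_subset t'
  refine ⟨t' + 1, ?_⟩
  rw [ht] at hqt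
  by_contra hc
  have hno : ∀ q, s ≤ q → q < s + l - 1 →
      (q ∈ p.erased (t' + 1) ↔ q + 1 ∈ p.erased (t' + 1)) := by
    intro q h1 h2
    by_contra h3
    refine hc (Finset.card_pos.2 ⟨q, ?_⟩)
    simp only [Finset.mem_filter, Finset.mem_Ico]
    exact ⟨⟨h1, h2⟩, h3⟩
  rw [Finset.mem_Ico] at hq
  have hs0 : s ∈ p.erased (t' + 1) := (p.mem_erased_iff_of_no_change hq.1
    fun r h1 h2 => hno r h1 (by omega)).2 hqt
  have hall : Finset.Ico s (s + l) ⊆ F := by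
    intro r hr
    have hr' := Finset.mem_Ico.1 hr
    have : r ∈ p.erased (t' + 1) := (p.mem_erased_iff_of_no_change hr'.1
      fun r h1 h2 => hno r h1 (by omega)).1 hs0
    rcases Finset.mem_union.1 (hsub this) with h | h
    · exact absurd ⟨r, hr, h⟩ hlt
    · exact h
  have := Finset.card_le_card hall
  rw [Nat.card_Ico] at this
  omega

theorem lt_of_erased_of_not_erased {t t' q : ℕ} (h : q ∈ p.erased t) (h' : q ∉ p.erased t') :
    t' < t := by
  by_contra hc
  exact h' (p.erased_mono (by omega) h)

theorem abs_charge_Xword_le {s i K : ℕ} (ha : ∀ i, 0 < a i) (hs : OccursAt w (Xword a i) s)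
    (hK : ∀ t x y, p.changes t x y ≤ K) (t : ℕ) :
    |p.charge t (s + (Xword a i).length) - p.charge t s| ≤
      K * ((∑ n ∈ Finset.range (i + 1), a n : ℕ) : ℤ) := by
  have hl := two_le_length_Xword ha i
  have hX := Xword_prefix_sums a i
  refine (p.abs_charge_sub_le (H := ((∑ n ∈ Finset.range (i + 1), a n : ℕ) : ℤ))
    (by omega) ?_ ?_).trans ?_
  · rw [hs.height_add le_rfl, List.take_length, hX.1, add_zero]
  · intro z h1 h2
    obtain ⟨j, rfl⟩ := Nat.exists_eq_add_of_le h1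
    rw [hs.height_add (by omega)]
    have := hX.2 j
    constructor <;> linarith
  · rw [mul_comm]
    exact mul_le_mul_of_nonneg_right (by exact_mod_cast hK _ _ _) (by positivity)

/-- If every level-`j` factor shows `g` changes at some time and levels `k` and `k + r + 2` are
high enough, then every factor of level `k + r + 2` shows `g + 1` changes at some time: otherwise
the level-`j` subfactors are swept from left to right or from right to left, and each crossing
between two of them consumes some of the bounded reserve of letters outside of the factor. -/
theorem ForcesChanges.step (ha : ∀ i, 0 < a i) {K j k r g : ℕ}
    (hK : ∀ t x y, p.changes t x y ≤ K) (hg : 1 ≤ g) (hjk : j ≤ k) (M : ℤ)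
    (hM : ∀ x, height w x ≤ M)
    (hκ : M < (2 ^ r - 1) * (((∑ n ∈ Finset.range (k + 1), a n : ℕ) : ℤ) -
      ((∑ n ∈ Finset.range (j + 1), a n : ℕ) : ℤ) -
      K * ((∑ n ∈ Finset.range (j + 1), a n : ℕ) : ℤ)))
    (hP : p.ForcesChanges a j g) : p.ForcesChanges a (k + r + 2) (g + 1) := by
  intro s₀ hs₀
  by_contra! hno
  choose! τ hτ using hP
  set l := (Xword a j).length with hl
  have hl2 : 2 ≤ l := two_le_length_Xword ha j
  set e := s₀ + (Xword a (k + r + 2)).length with he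
  -- at the time `τ u`, all changes within the large factor lie within `u`
  have hchange : ∀ u, IsSubfactor a (k + r + 2) s₀ j u → ∀ q, s₀ ≤ q → q + 1 < e →
      (q < u ∨ u + l ≤ q + 1) → (q ∈ p.erased (τ u) ↔ q + 1 ∈ p.erased (τ u)) := by
    intro u hu q h1 h2 h3
    by_contra h4
    have hsub := Finset.filter_subset_filter
      (fun q => ¬(q ∈ p.erased (τ u) ↔ q + 1 ∈ p.erased (τ u)))
      (Finset.Ico_subset_Ico hu.start_le (Nat.sub_le_sub_right hu.end_le 1))
    have heq := Finset.eq_of_subset_of_card_le hsub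
      ((Nat.lt_succ_iff.1 (hno (τ u))).trans (hτ u (hu.occursAt hs₀)))
    have hq : q ∈ (Finset.Ico s₀ (s₀ + (Xword a (k + r + 2)).length - 1)).filter
        fun q => ¬(q ∈ p.erased (τ u) ↔ q + 1 ∈ p.erased (τ u)) := by
      simp only [Finset.mem_filter, Finset.mem_Ico]
      exact ⟨⟨h1, by omega⟩, h4⟩
    rw [← heq, Finset.mem_filter, Finset.mem_Ico] at hq
    omega
  have hleft : ∀ u, IsSubfactor a (k + r + 2) s₀ j u → ∀ q, s₀ ≤ q → q ≤ u →
      (q ∈ p.erased (τ u) ↔ u ∈ p.erased (τ u)) := by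
    intro u hu q h1 h2
    have := hu.end_le
    exact p.mem_erased_iff_of_no_change h2 fun r h3 h4 =>
      hchange u hu r (by omega) (by omega) (by omega)
  have hright : ∀ u, IsSubfactor a (k + r + 2) s₀ j u → ∀ q, u + l - 1 ≤ q → q < e →
      (q ∈ p.erased (τ u) ↔ u + l - 1 ∈ p.erased (τ u)) := by
    intro u hu q h1 h2
    have := hu.start_le
    exact (p.mem_erased_iff_of_no_change h1 fun r h3 h4 =>
      hchange u hu r (by omega) (by omega) (by omega)).symm
  have hpart : ∀ u, IsSubfactor a (k + r + 2) s₀ j u →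
      (∃ q, u ≤ q ∧ q < u + l ∧ q ∈ p.erased (τ u)) ∧
        ∃ q, u ≤ q ∧ q < u + l ∧ q ∉ p.erased (τ u) := fun u hu =>
    p.exists_mem_and_not_mem_of_changes_pos (hg.trans (hτ u (hu.occursAt hs₀)))
  -- comparison of the times of two subfactors
  have hlt : ∀ u u', IsSubfactor a (k + r + 2) s₀ j u → IsSubfactor a (k + r + 2) s₀ j u' →
      u + l ≤ u' → (u + l - 1 ∉ p.erased (τ u) → τ u < τ u') ∧
        (u + l - 1 ∈ p.erased (τ u) → τ u' < τ u) ∧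
        (u' ∈ p.erased (τ u') → τ u < τ u') ∧ (u' ∉ p.erased (τ u') → τ u' < τ u) := by
    intro u u' hu hu' huu'
    obtain ⟨⟨x, hx1, hx2, hx⟩, ⟨y, hy1, hy2, hy⟩⟩ := hpart u hu
    obtain ⟨⟨x', hx1', hx2', hx'⟩, ⟨y', hy1', hy2', hy'⟩⟩ := hpart u' hu'
    have h1 := hu'.end_le
    have h2 := hu.start_le
    refine ⟨fun h => ?_, fun h => ?_, fun h => ?_, fun h => ?_⟩
    · exact p.lt_of_erased_of_not_erased hx'
        (mt (hright u hu x' (by omega) (by omega)).1 h)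
    · exact p.lt_of_erased_of_not_erased
        ((hright u hu y' (by omega) (by omega)).2 h) hy'
    · exact p.lt_of_erased_of_not_erased
        ((hleft u' hu' y (by omega) (by omega)).2 h) hy
    · exact p.lt_of_erased_of_not_erased hx
        (mt (hleft u' hu' x (by omega) (by omega)).1 h)
  have hiff : ∀ u u', IsSubfactor a (k + r + 2) s₀ j u → IsSubfactor a (k + r + 2) s₀ j u' →
      u + l ≤ u' → (u + l - 1 ∈ p.erased (τ u) ↔ u' ∉ p.erased (τ u')) := by
    intro u u' hu hu' huu'
    obtain ⟨h1, h2, h3, h4⟩ := hlt u u' hu hu' huu'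
    constructor
    · intro h h'
      exact absurd (h2 h) (h3 h').asymm
    · intro h
      by_contra h'
      exact absurd (h4 h) (h1 h').asymm
  have hbound := fun u (hu : IsSubfactor a (k + r + 2) s₀ j u) t =>
    p.abs_charge_Xword_le ha (hu.occursAt hs₀) hK t
  set B := ((∑ n ∈ Finset.range (j + 1), a n : ℕ) : ℤ) with hB
  -- choose a subfactor `v` strictly inside the large factor, and `u₁`, `u₂` on both sides of it
  obtain ⟨u₁, hu₁⟩ := IsSubfactor.exists_of_le a
    (s₀ + a (k + r + 1 + 1) + a (k + r + 1)) (show j ≤ k + r by omega)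
  obtain ⟨u₂, hu₂⟩ := IsSubfactor.exists_of_le a
    (s₀ + (a (k + r + 1 + 1) + (Xword a (k + r + 1)).length)) (show j ≤ k + r + 1 by omega)
  set v := s₀ + a (k + r + 1 + 1) + (a (k + r + 1) + (Xword a (k + r)).length) with hv
  have hsv : IsSubfactor a (k + r + 2) s₀ (k + r) v := .left (.right (.refl _ _))
  have hs₁ : IsSubfactor a (k + r + 2) s₀ j u₁ := .left (.left hu₁)
  have hs₂ : IsSubfactor a (k + r + 2) s₀ j u₂ := .right hu₂
  have hside : ∀ u, IsSubfactor a (k + r) v j u → u₁ + l ≤ u ∧ u + l ≤ u₂ := by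
    intro u hu
    have h1 := hu.start_le
    have h2 := hu.end_le
    have h3 := hu₁.end_le
    have h4 := hu₂.start_le
    have h5 := Xword_length_succ a (k + r)
    omega
  have htypeL : ∀ u, IsSubfactor a (k + r) v j u →
      (u ∈ p.erased (τ u) ↔ u₁ + l - 1 ∉ p.erased (τ u₁)) := by
    intro u hu
    have := hiff u₁ u hs₁ (hsv.trans hu) (hside u hu).1
    tauto
  have htypeR : ∀ u, IsSubfactor a (k + r) v j u →
      (u + l - 1 ∈ p.erased (τ u) ↔ u₁ + l - 1 ∈ p.erased (τ u₁)) := by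
    intro u hu
    have h1 := hiff u u₂ (hsv.trans hu) hs₂ (hside u hu).2
    have h2 := hiff u₁ u₂ hs₁ hs₂ (by have := hside u hu; omega)
    tauto
  -- geometry of a crossing
  have hcross : ∀ n q u u', k ≤ n → IsSubfactor a (k + r) v (n + 1) q →
      IsSubfactor a n (q + a (n + 1)) j u →
      IsSubfactor a n (q + (a (n + 1) + (Xword a n).length)) j u' →
      ∃ m, u + l ≤ m ∧ m ≤ u' ∧ ((∑ n ∈ Finset.range (k + 1), a n : ℕ) : ℤ) - B ≤
        height w u - height w m ∧ height w u' = height w u := by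
    intro n q u u' hn hq hu hu'
    refine ⟨q + (a (n + 1) + (Xword a n).length), ?_, hu'.start_le, ?_, ?_⟩
    · have := hu.end_le
      omega
    · have h1 := ((hsv.trans hq).trans hu.left).height_add hs₀
      have h2 := ((hsv.trans hq).trans (IsSubfactor.refl _ _).right).height_add hs₀
      have h3 : ((∑ n ∈ Finset.range (k + 1), a n : ℕ) : ℤ) ≤
          ((∑ i ∈ Finset.range (n + 1), a i : ℕ) : ℤ) := by
        exact_mod_cast Finset.sum_le_sum_of_subset (by simpa using hn)
      linarith
    · have h1 := ((hsv.trans hq).trans hu.left).height_add hs₀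
      have h2 := ((hsv.trans hq).trans hu'.right).height_add hs₀
      linarith
  set A := ((∑ n ∈ Finset.range (k + 1), a n : ℕ) : ℤ) with hA
  have hheight_e : height w e = height w s₀ := by
    rw [he, hs₀.height_add le_rfl, List.take_length, (Xword_prefix_sums a _).1, add_zero]
  have hheight_l : ∀ u, IsSubfactor a (k + r + 2) s₀ j u →
      height w (u + l) = height w u := by
    intro u hu
    rw [(hu.occursAt hs₀).height_add le_rfl, List.take_length, (Xword_prefix_sums a _).1,
      add_zero]
  by_cases hty : u₁ + l - 1 ∈ p.erased (τ u₁)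
  · -- sweep from right to left
    obtain ⟨x, y, hx, hy, hxy⟩ := IsSubfactor.exists_increase (a := a) (s := v)
      (fun u => - p.charge (τ u) e) (A - B - K * B) hjk r (by
      intro n q u u' hn hq hu hu'
      obtain ⟨m, hm1, hm2, hm3, hm4⟩ := hcross n q u u' hn hq hu hu'
      have hvu := hq.trans hu.left
      have hvu' := hq.trans hu'.right
      have hsu := hsv.trans hvu
      have hsu' := hsv.trans hvu'
      have hL' : u' ∉ p.erased (τ u') := by rw [htypeL u' hvu']; simpa using hty
      have hR := (htypeR u hvu).2 hty
      have hR' := (htypeR u' hvu').2 hty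
      have b1 := hsu.start_le
      have b2 := hsu'.end_le
      have hmono := p.charge_mono ((hlt u u' hsu hsu' (by omega)).2.1 hR).le m
      have c1 := p.charge_of_not_erased (t := τ u') hm2 fun z h1 h2 =>
        mt (hleft u' hsu' z (by omega) (by omega)).1 hL'
      have c2 := (abs_le.1 (hbound u' hsu' (τ u'))).2
      have c3 := p.charge_of_erased (t := τ u') (x := u' + l) (y := e) (by omega) fun z h1 h2 =>
        (hright u' hsu' z (by omega) (by omega)).2 hR'
      have c4 := p.charge_of_erased (t := τ u) (x := m) (y := e) (by omega) fun z h1 h2 =>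
        (hright u hsu z (by omega) (by omega)).2 hR
      rw [hheight_l u' hsu'] at c3
      change p.charge _ (u' + l) - _ ≤ _ at c2
      change -p.charge (τ u) e + _ ≤ -p.charge (τ u') e
      linarith)
    have h1 := p.charge_nonneg (τ y) e
    have h2 := p.charge_le_height (τ x) e
    have h3 := hM e
    linarith
  · -- sweep from left to right
    obtain ⟨x, y, hx, hy, hxy⟩ := IsSubfactor.exists_increase (a := a) (s := v)
      (fun u => p.charge (τ u) s₀) (A - B - K * B) hjk r (by
      intro n q u u' hn hq hu hu'
      obtain ⟨m, hm1, hm2, hm3, hm4⟩ := hcross n q u u' hn hq hu hu'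
      have hvu := hq.trans hu.left
      have hvu' := hq.trans hu'.right
      have hsu := hsv.trans hvu
      have hsu' := hsv.trans hvu'
      have hL := (htypeL u hvu).2 hty
      have hL' := (htypeL u' hvu').2 hty
      have hR := mt (htypeR u hvu).1 hty
      have b1 := hsu.start_le
      have b2 := hsu'.end_le
      have hmono := p.charge_mono ((hlt u u' hsu hsu' (by omega)).1 hR).le m
      have c1 := p.charge_of_erased (t := τ u) b1 fun z h1 h2 =>
        (hleft u hsu z (by omega) (by omega)).2 hL
      have c2 := (abs_le.1 (hbound u hsu (τ u))).1
      have c3 := p.charge_of_not_erased (t := τ u) hm1 fun z h1 h2 =>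
        mt (hright u hsu z (by omega) (by omega)).1 hR
      have c4 := p.charge_of_erased (t := τ u') (x := s₀) (y := m) (by omega) fun z h1 h2 =>
        (hleft u' hsu' z (by omega) (by omega)).2 hL'
      change _ ≤ p.charge _ (u + l) - _ at c2
      change p.charge (τ u) s₀ + _ ≤ p.charge (τ u') s₀
      linarith)
    have h1 := p.charge_nonneg (τ x) s₀
    have h2 := p.charge_le_height (τ y) s₀
    have h3 := hM s₀
    linarith

theorem changes_le_two_mul_repWidth (t x y : ℕ) : p.changes t x y ≤ 2 * repWidth p := by
  have h1 : p.changes t x y ≤ 2 * setWidth (p.erased t) :=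
    card_boundary_le _ _ fun q hq => (Finset.mem_filter.1 hq).2
  have h2 : setWidth (p.erased t) ≤ repWidth p := by
    have h3 : p.erased t = p.erased (min t p.pairs.length) := by
      unfold erased
      rcases le_total t p.pairs.length with h | h
      · rw [min_eq_left h]
      · rw [min_eq_right h, List.take_of_length_le h, List.take_length]
    rw [h3]
    exact Finset.le_sup (f := fun t => setWidth (p.erased t))
      (Finset.mem_range.2 (by omega : min t p.pairs.length < p.pairs.length + 1))
  omega

end RePairing

theorem sum_range_mul_two_pow_div {l : ℕ} (hl : 0 < l) (j : ℕ) :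
    (∑ n ∈ Finset.range (j * l), 2 ^ (n / l)) + l = l * 2 ^ j := by
  induction j with
  | zero => simp
  | succ j ih =>
    have h : ∀ x ∈ Finset.range l, 2 ^ ((j * l + x) / l) = 2 ^ j := by
      intro x hx
      rw [Nat.mul_comm, Nat.mul_add_div hl, Nat.div_eq_of_lt (Finset.mem_range.1 hx), add_zero]
    rw [Nat.succ_mul, Finset.sum_range_add, Finset.sum_congr rfl h, Finset.sum_const,
      Finset.card_range, smul_eq_mul, pow_succ]
    linarith

theorem RePairing.ForcesChanges.block_step {w : List ℤ} (p : RePairing w) {l m L K j g b : ℕ}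
    (hl : 3 ≤ l) (hL : l < 2 ^ (L + 1)) (hK : ∀ t x y, p.changes t x y ≤ K) (hKl : K + 1 ≤ l)
    (hM : ∀ x, height w x ≤ l * 2 ^ m) (hj : 1 ≤ j) (hb : 1 ≤ b) (hm : m + 3 ≤ j + b * l)
    (hg : 1 ≤ g) (hP : p.ForcesChanges (fun i => 2 ^ (i / l)) (j * l - 1) g) :
    p.ForcesChanges (fun i => 2 ^ (i / l)) ((j + (L + 2) + b) * l - 1) (g + 1) := by
  have hbl : l ≤ b * l := Nat.le_mul_of_pos_left l hb
  have hjl : l ≤ j * l := Nat.le_mul_of_pos_left l hj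
  have hkl : (j + (L + 2)) * l = j * l + (L + 2) * l := add_mul _ _ _
  have htot : (j + (L + 2) + b) * l - 1 = (j + (L + 2)) * l - 1 + (b * l - 2) + 2 := by
    rw [add_mul _ b]
    omega
  rw [htot]
  refine hP.step p (fun i => by positivity) hK hg (by omega) (l * 2 ^ m) hM ?_
  rw [Nat.sub_add_cancel (by omega), Nat.sub_add_cancel (by omega)]
  have hA := sum_range_mul_two_pow_div (by omega : 0 < l) (j + (L + 2))
  have hB := sum_range_mul_two_pow_div (by omega : 0 < l) j
  zify at hA hB hKl hL
  push_cast
  set A := ∑ n ∈ Finset.range ((j + (L + 2)) * l), (2 : ℤ) ^ (n / l)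
  set B := ∑ n ∈ Finset.range (j * l), (2 : ℤ) ^ (n / l)
  have hB0 : 0 ≤ B := Finset.sum_nonneg fun _ _ => by positivity
  obtain ⟨r, hr⟩ : ∃ r, b * l - 2 = r + 1 := ⟨b * l - 3, by omega⟩
  rw [hr]
  have hl0 : (3 : ℤ) ≤ l := by exact_mod_cast hl
  have h1 : (l : ℤ) * 2 ^ j < A - B - K * B := by
    have h2 : (K + 1) * B ≤ l * B := mul_le_mul_of_nonneg_right hKl hB0
    have h3 : (l : ℤ) * B = l * (l * 2 ^ j) - l * l := by rw [← hB]; ring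
    have h4 : (l : ℤ) * 2 ^ (j + (L + 2)) = (l * 2 ^ j) * (2 * 2 ^ (L + 1)) := by ring
    have h5 : (l * 2 ^ j) * (l + 1) ≤ ((l : ℤ) * 2 ^ j) * (2 * 2 ^ (L + 1)) :=
      mul_le_mul_of_nonneg_left (by linarith) (by positivity)
    nlinarith
  have h2 : (2 : ℤ) ^ r ≤ 2 ^ (r + 1) - 1 := by
    have : (1 : ℤ) ≤ 2 ^ r := one_le_pow₀ (by norm_num)
    rw [pow_succ]
    linarith
  calc (l : ℤ) * 2 ^ m ≤ l * 2 ^ (j + r) :=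
        mul_le_mul_of_nonneg_left (pow_le_pow_right₀ (by norm_num) (by omega)) (by positivity)
    _ = 2 ^ r * (l * 2 ^ j) := by ring
    _ < 2 ^ r * (A - B - K * B) := mul_lt_mul_of_pos_left h1 (by positivity)
    _ ≤ _ := mul_le_mul_of_nonneg_right h2 (le_of_lt (lt_of_le_of_lt (by positivity) h1))

theorem le_dyckWidth_Yword {l m L : ℕ} (hL64 : 64 ≤ L) (hl100 : 100 ≤ l) (hL : l < 2 ^ (L + 1))
    (hm : l * L ≤ m) (hm' : m ≤ l * (L + 1)) : l ≤ 4 * (dyckWidth (Yword m l) + 1) := by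
  by_contra! hlt
  set a : ℕ → ℕ := fun i => 2 ^ (i / l) with ha
  have ha0 : ∀ i, 0 < a i := fun i => by positivity
  obtain ⟨p, hp⟩ : dyckWidth (Yword m l) ∈
      {k | ∃ p : RePairing (Yword m l), repWidth p = k} :=
    Nat.sInf_mem ((nonempty_rePairing_Xword a (m * l - 1)).elim fun p => ⟨_, p, rfl⟩)
  have hK : ∀ t x y, p.changes t x y ≤ 2 * dyckWidth (Yword m l) := by
    intro t x y
    rw [← hp]
    exact p.changes_le_two_mul_repWidth t x y
  set d := dyckWidth (Yword m l) with hd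
  have hlL : 64 * l ≤ l * L := by nlinarith
  have hLl : 100 * L ≤ l * L := by nlinarith
  have hml : m ≤ m * l := Nat.le_mul_of_pos_right m (by omega)
  have hM : ∀ x, height (Yword m l) x ≤ l * 2 ^ m := by
    intro x
    have h1 := ((Xword_prefix_sums a (m * l - 1)).2 x).2
    have h2 := sum_range_mul_two_pow_div (by omega : 0 < l) m
    rw [Nat.sub_add_cancel (by omega)] at h1
    refine h1.trans ?_
    zify at h2
    push_cast [ha]
    linarith
  have step := fun (j g b : ℕ) => RePairing.ForcesChanges.block_step p (l := l) (m := m) (L := L)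
    (K := 2 * d) (j := j) (g := g) (b := b) (by omega) hL hK (by omega) hM
  have hlower : ∀ i, p.ForcesChanges a ((1 + i * (2 * L + 4)) * l - 1) (1 + i) := by
    intro i
    induction i with
    | zero => exact (p.forcesChanges_one ha0).mono p (by omega)
    | succ i ih =>
      have := step _ _ (L + 2) (by omega) (by omega) (by nlinarith) (by omega) ih
      rwa [show 1 + i * (2 * L + 4) + (L + 2) + (L + 2) = 1 + (i + 1) * (2 * L + 4) by ring,
        add_assoc 1 i 1] at this
  set c := l / 4 + 1 with hc
  have hupper : ∀ i, p.ForcesChanges a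
      ((1 + c * (2 * L + 4) + i * (L + L / 2 + 5)) * l - 1) (1 + c + i) := by
    intro i
    induction i with
    | zero => simpa using hlower c
    | succ i ih =>
      have h1 : l * (2 * L + 4) ≤ 4 * (c * (2 * L + 4)) := by
        rw [← mul_assoc]
        exact Nat.mul_le_mul_right _ (by omega)
      have h2 : (L + 5) * l ≤ 2 * ((L / 2 + 3) * l) := by
        rw [← mul_assoc]
        exact Nat.mul_le_mul_right _ (by omega)
      have := step _ _ (L / 2 + 3) (by omega) (by omega) (by nlinarith) (by omega) ih
      rwa [show 1 + c * (2 * L + 4) + i * (L + L / 2 + 5) + (L + 2) + (L / 2 + 3) =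
        1 + c * (2 * L + 4) + (i + 1) * (L + L / 2 + 5) by ring, add_assoc (1 + c) i 1] at this
  have hfit : 1 + c * (2 * L + 4) + c * (L + L / 2 + 5) ≤ m := by
    have h1 : 4 * c * (2 * (3 * L + L / 2 + 9)) ≤ (l + 4) * (7 * L + 18) :=
      Nat.mul_le_mul (by omega) (by omega)
    nlinarith
  have hroot := (hupper c).mono p
    (Nat.sub_le_sub_right (Nat.mul_le_mul_right l hfit) 1)
  obtain ⟨t, ht⟩ := hroot 0 ⟨[], [], by simp [Yword, ha], rfl⟩
  have := ht.trans (hK _ _ _)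
  omega

/-- width(Y(ℓ)) = Ω(ℓ); in fact width(Y(ℓ)) ≥ ℓ/4 − 1 for all large ℓ. -/
theorem dyckWidth_YwordL_lower :
    (∃ (c : ℝ) (L₀ : ℕ), 0 < c ∧ ∀ ℓ : ℕ, L₀ ≤ ℓ →
      c * (ℓ : ℝ) ≤ (dyckWidth (YwordL ℓ) : ℝ)) ∧
    ∃ L₁ : ℕ, ∀ ℓ : ℕ, L₁ ≤ ℓ →
      (ℓ : ℝ) / 4 - 1 ≤ (dyckWidth (YwordL ℓ) : ℝ) := by
  have key : ∀ ℓ : ℕ, 2 ^ 64 ≤ ℓ → (ℓ : ℝ) / 4 - 1 ≤ (dyckWidth (YwordL ℓ) : ℝ) := by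
    intro ℓ hℓ
    have hpos : 0 < ℓ := lt_of_lt_of_le (by positivity) hℓ
    have hlog : 64 ≤ Nat.log 2 ℓ := (Nat.le_log_iff_pow_le (by norm_num) hpos.ne').2 hℓ
    have hlt : ℓ < 2 ^ (Nat.log 2 ℓ + 1) := Nat.lt_pow_succ_log_self (by norm_num) ℓ
    have h := le_dyckWidth_Yword (l := ℓ) (m := ⌊(ℓ : ℝ) * Real.logb 2 (ℓ : ℝ)⌋₊) hlog
      (le_trans (by norm_num) hℓ) hlt ?_ ?_
    · have h' : (ℓ : ℝ) ≤ 4 * ((dyckWidth (YwordL ℓ) : ℝ) + 1) := by exact_mod_cast h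
      linarith
    · refine Nat.le_floor ?_
      push_cast
      exact mul_le_mul_of_nonneg_left (by exact_mod_cast Real.natLog_le_logb ℓ 2) (by positivity)
    · refine Nat.floor_le_of_le ?_
      push_cast
      refine mul_le_mul_of_nonneg_left ?_ (by positivity)
      rw [Real.logb_le_iff_le_rpow (by norm_num) (by exact_mod_cast hpos)]
      exact_mod_cast hlt.le
  refine ⟨⟨1 / 8, 2 ^ 64, by norm_num, fun ℓ hℓ => ?_⟩, 2 ^ 64, key⟩
  have h1 := key ℓ hℓ
  have h2 : (8 : ℝ) ≤ ℓ := by exact_mod_cast le_trans (by norm_num) hℓ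
  linarith
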